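/- Let m ≥ 2 be an even integer, let τ_γ > 0 for γ = 0,1,…,m−1, τ_m = 1, and let 0 ≤ β < 2m. If α > (1 − β/(2m))·(4π)^m·m!, then for every constant C > 0 there exists a smooth compactly supported function u : ℝ^{2m} → ℝ with ‖u‖_{Ẽ} ≤ 1 such that ∫_{ℝ^{2m}} (e^{α u²} − 1)/|x|^β dx > C; that is, the supremum over {‖u‖_{Ẽ} ≤ 1} of this integral is infinite. (Sharpness of the Adams-type inequality, Theorem 1.1.) -/

import Mathlib

open MeasureTheory Real Filter Topology

noncomputable section

abbrev Euc (n : ℕ) := EuclideanSpace ℝ (Fin n)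

/-- The Laplacian of `u : ℝⁿ → ℝ`, computed as the sum of second partial derivatives. -/
noncomputable def lap (n : ℕ) (u : Euc n → ℝ) : Euc n → ℝ :=
  fun x => ∑ i : Fin n,
    fderiv ℝ (fun y => fderiv ℝ u y (EuclideanSpace.single i 1)) x (EuclideanSpace.single i 1)

/-- Iterated Laplacian `Δ^k u`. -/
noncomputable def lapIter (n : ℕ) : ℕ → (Euc n → ℝ) → (Euc n → ℝ)
  | 0 => id
  | k+1 => fun u => lap n (lapIter n k u)

/-- `|∇^γ u|²`, where `∇^γ u = Δ^{γ/2} u` for even `γ` and `∇^γ u = ∇(Δ^{(γ-1)/2} u)` for odd. -/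
noncomputable def gradNormSq (n γ : ℕ) (u : Euc n → ℝ) : Euc n → ℝ :=
  fun x => if γ % 2 = 0 then (lapIter n (γ/2) u x)^2
    else ∑ i : Fin n, (fderiv ℝ (lapIter n (γ/2) u) x (EuclideanSpace.single i 1))^2



lemma contDiff_lap {n : ℕ} {u : Euc n → ℝ} (hu : ContDiff ℝ (⊤ : ℕ∞) u) :
    ContDiff ℝ (⊤ : ℕ∞) (lap n u) := by
  unfold lap
  refine ContDiff.sum fun i _ => ?_
  have h1 : ContDiff ℝ (⊤ : ℕ∞) (fun y => fderiv ℝ u y (EuclideanSpace.single i 1)) :=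
    (hu.fderiv_right (m := (⊤ : ℕ∞)) (by simp)).clm_apply contDiff_const
  exact (h1.fderiv_right (m := (⊤ : ℕ∞)) (by simp)).clm_apply contDiff_const

lemma contDiff_pd {n : ℕ} {u : Euc n → ℝ} (hu : ContDiff ℝ (⊤ : ℕ∞) u) (v : Euc n) :
    ContDiff ℝ (⊤ : ℕ∞) (fun y => fderiv ℝ u y v) :=
  (hu.fderiv_right (m := (⊤ : ℕ∞)) (by simp)).clm_apply contDiff_const

lemma contDiff_lapIter {n : ℕ} {u : Euc n → ℝ} (hu : ContDiff ℝ (⊤ : ℕ∞) u) (k : ℕ) :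
    ContDiff ℝ (⊤ : ℕ∞) (lapIter n k u) := by
  induction k with
  | zero => exact hu
  | succ k ih => exact contDiff_lap ih

lemma lap_comp_smul {n : ℕ} (u : Euc n → ℝ) (a : ℝ) :
    lap n (fun x => u (a • x)) = fun x => a ^ 2 * lap n u (a • x) := by
  funext x
  unfold lap
  rw [Finset.mul_sum]
  refine Finset.sum_congr rfl fun i _ => ?_
  have h1 : (fun y => fderiv ℝ (fun x => u (a • x)) y (EuclideanSpace.single i 1)) =
      a • (fun y => (fun z => fderiv ℝ u z (EuclideanSpace.single i 1)) (a • y)) := by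
    funext y
    rw [fderiv_comp_smul]
    simp
  rw [h1, fderiv_const_smul_field, Pi.smul_apply,
    fderiv_comp_smul (f := fun z => fderiv ℝ u z (EuclideanSpace.single i 1))]
  simp
  ring

lemma lap_const_mul {n : ℕ} (u : Euc n → ℝ) (a : ℝ) :
    lap n (fun x => a * u x) = fun x => a * lap n u x := by
  funext x
  unfold lap
  rw [Finset.mul_sum]
  refine Finset.sum_congr rfl fun i _ => ?_
  have h1 : (fun y => fderiv ℝ (fun x => a * u x) y (EuclideanSpace.single i 1)) =
      a • (fun y => fderiv ℝ u y (EuclideanSpace.single i 1)) := by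
    funext y
    have : (fun x => a * u x) = a • u := rfl
    rw [this, fderiv_const_smul_field]
    simp
  rw [h1, fderiv_const_smul_field]
  simp

lemma lapIter_comp_smul {n : ℕ} (u : Euc n → ℝ) (a : ℝ) (k : ℕ) :
    lapIter n k (fun x => u (a • x)) = fun x => a ^ (2 * k) * lapIter n k u (a • x) := by
  induction k with
  | zero => funext x; simp [lapIter]
  | succ k ih =>
    show lap n (lapIter n k _) = fun x => _ * lap n (lapIter n k u) (a • x)
    rw [ih, lap_const_mul, lap_comp_smul]
    funext x
    ring

lemma lapIter_const_mul {n : ℕ} (u : Euc n → ℝ) (a : ℝ) (k : ℕ) :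
    lapIter n k (fun x => a * u x) = fun x => a * lapIter n k u x := by
  induction k with
  | zero => rfl
  | succ k ih =>
    show lap n (lapIter n k _) = fun x => _ * lap n (lapIter n k u) x
    rw [ih, lap_const_mul]

lemma lap_add {n : ℕ} {u v : Euc n → ℝ} (hu : ContDiff ℝ (⊤ : ℕ∞) u)
    (hv : ContDiff ℝ (⊤ : ℕ∞) v) :
    lap n (fun x => u x + v x) = fun x => lap n u x + lap n v x := by
  funext x
  unfold lap
  rw [← Finset.sum_add_distrib]
  refine Finset.sum_congr rfl fun i _ => ?_
  have h1 : (fun y => fderiv ℝ (fun x => u x + v x) y (EuclideanSpace.single i 1)) =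
      (fun y => fderiv ℝ u y (EuclideanSpace.single i 1) +
        fderiv ℝ v y (EuclideanSpace.single i 1)) := by
    funext y
    rw [fderiv_fun_add (hu.differentiable (by simp) y) (hv.differentiable (by simp) y)]
    simp
  rw [h1, fderiv_fun_add ((contDiff_pd hu _).differentiable (by simp) x)
    ((contDiff_pd hv _).differentiable (by simp) x)]
  simp

lemma lapIter_add {n : ℕ} {u v : Euc n → ℝ} (hu : ContDiff ℝ (⊤ : ℕ∞) u)
    (hv : ContDiff ℝ (⊤ : ℕ∞) v) (k : ℕ) :
    lapIter n k (fun x => u x + v x) = fun x => lapIter n k u x + lapIter n k v x := by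
  induction k with
  | zero => rfl
  | succ k ih =>
    show lap n (lapIter n k _) = fun x => lap n (lapIter n k u) x + lap n (lapIter n k v) x
    rw [ih, lap_add (contDiff_lapIter hu k) (contDiff_lapIter hv k)]

lemma lapIter_const {n : ℕ} (c : ℝ) (k : ℕ) :
    lapIter n (k + 1) (fun _ => c) = fun _ => 0 := by
  induction k with
  | zero => funext x; simp [lapIter, lap]
  | succ k ih =>
    show lap n (lapIter n (k + 1) _) = _
    rw [ih]
    funext x; simp [lap]

lemma lap_congr {n : ℕ} {u v : Euc n → ℝ} {x : Euc n} (h : u =ᶠ[𝓝 x] v) :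
    lap n u =ᶠ[𝓝 x] lap n v := by
  have key : ∀ y, u =ᶠ[𝓝 y] v → lap n u y = lap n v y := by
    intro y hy
    unfold lap
    refine Finset.sum_congr rfl fun i _ => ?_
    have : (fun y => fderiv ℝ u y (EuclideanSpace.single i 1)) =ᶠ[𝓝 y]
        (fun y => fderiv ℝ v y (EuclideanSpace.single i 1)) := by
      filter_upwards [hy.fderiv (𝕜 := ℝ)] with z hz
      rw [hz]
    rw [this.fderiv_eq]
  filter_upwards [h.eventuallyEq_nhds] with y hy using key y hy

lemma lapIter_congr {n : ℕ} {u v : Euc n → ℝ} {x : Euc n} (h : u =ᶠ[𝓝 x] v) (k : ℕ) :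
    lapIter n k u =ᶠ[𝓝 x] lapIter n k v := by
  induction k with
  | zero => exact h
  | succ k ih => exact lap_congr ih

lemma tsupport_lapIter {n : ℕ} {u : Euc n → ℝ} (k : ℕ) :
    tsupport (lapIter n k u) ⊆ tsupport u := by
  intro x hx
  by_contra hxu
  revert hx
  change x ∉ _
  have := (notMem_tsupport_iff_eventuallyEq.1 hxu)
  have h2 := lapIter_congr this k
  rw [notMem_tsupport_iff_eventuallyEq]
  have h3 : lapIter n k (0 : Euc n → ℝ) = 0 := by
    cases k with
    | zero => rfl
    | succ k => exact lapIter_const 0 k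
  rwa [h3] at h2

lemma lap_radial {n : ℕ} (g g' g'' : ℝ → ℝ) (h1 : ∀ s, 0 < s → HasDerivAt g (g' s) s)
    (h2 : ∀ s, 0 < s → HasDerivAt g' (g'' s) s) (x : Euc n) (hx : x ≠ 0) :
    lap n (fun y => g (‖y‖ ^ 2)) x = 4 * ‖x‖ ^ 2 * g'' (‖x‖ ^ 2) + 2 * n * g' (‖x‖ ^ 2) := by
  have hin : ∀ (y : Euc n) (i : Fin n), inner ℝ y (EuclideanSpace.single i (1:ℝ)) = y i := by
    intro y i
    rw [EuclideanSpace.inner_single_right]; simp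
  have hd : ∀ (G G' : ℝ → ℝ), (∀ s, 0 < s → HasDerivAt G (G' s) s) → ∀ y : Euc n, y ≠ 0 →
      HasFDerivAt (fun y : Euc n => G (‖y‖ ^ 2)) (G' (‖y‖^2) • (2 • innerSL ℝ y)) y := by
    intro G G' hG y hy
    have hp : 0 < ‖y‖ ^ 2 := by positivity
    exact (hG _ hp).comp_hasFDerivAt y (hasStrictFDerivAt_norm_sq y).hasFDerivAt
  have e : ∀ i : Fin n, fderiv ℝ (fun y => fderiv ℝ (fun y : Euc n => g (‖y‖ ^ 2)) y (EuclideanSpace.single i 1)) x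
      (EuclideanSpace.single i 1) = 4 * (x i) ^ 2 * g'' (‖x‖ ^ 2) + 2 * g' (‖x‖ ^ 2) := by
    intro i
    have ev : (fun y => fderiv ℝ (fun y : Euc n => g (‖y‖ ^ 2)) y (EuclideanSpace.single i 1)) =ᶠ[𝓝 x]
        fun y => g' (‖y‖ ^ 2) * (2 * (EuclideanSpace.proj (𝕜 := ℝ) i y)) := by
      filter_upwards [isOpen_ne.mem_nhds hx] with y hy
      rw [(hd g g' h1 y hy).fderiv]
      simp [hin]
    rw [ev.fderiv_eq]
    have h3 := (hd g' g'' h2 x hx).mul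
      (((EuclideanSpace.proj (𝕜 := ℝ) i : Euc n →L[ℝ] ℝ).hasFDerivAt (x := x)).const_mul (2:ℝ))
    have h4 := h3.fderiv
    rw [show (fun y : Euc n => g' (‖y‖ ^ 2) * (2 * (EuclideanSpace.proj (𝕜 := ℝ) i y))) =
      ((fun y : Euc n => g' (‖y‖ ^ 2)) * fun y : Euc n => (2 * (EuclideanSpace.proj (𝕜 := ℝ) i y))) from rfl, h4]
    simp [hin]
    ring
  unfold lap
  rw [Finset.sum_congr rfl fun i _ => e i, Finset.sum_add_distrib, ← Finset.sum_mul, ← Finset.mul_sum,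
    EuclideanSpace.norm_sq_eq]
  simp
  ring

/-- coefficients -/
def cf (n : ℕ) : ℕ → ℝ
  | 0 => (n : ℝ) - 2
  | j + 1 => 2 * (j + 1) * (2 * (j + 1) + 2 - n) * cf n j

lemma lapIter_log {n : ℕ} (j : ℕ) (x : Euc n) (hx : x ≠ 0) :
    lapIter n (j + 1) (fun y => 1 / 2 * Real.log (‖y‖ ^ 2)) x = cf n j * ((‖x‖ ^ 2) ^ (j + 1))⁻¹ := by
  induction j generalizing x with
  | zero =>
    show lap n (fun y => (fun s => 1 / 2 * Real.log s) (‖y‖ ^ 2)) x = _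
    have hp : ‖x‖ ≠ 0 := by simpa using hx
    rw [lap_radial _ (fun s => 1 / 2 * s⁻¹) (fun s => 1 / 2 * (-(s^2)⁻¹))
      (fun s hs => (Real.hasDerivAt_log hs.ne').const_mul _)
      (fun s hs => (hasDerivAt_inv hs.ne').const_mul _) x hx]
    simp only [cf]
    field_simp
    ring
  | succ j ih =>
    show lap n (lapIter n (j + 1) _) x = _
    have hp : ‖x‖ ≠ 0 := by simpa using hx
    have ev : lapIter n (j + 1) (fun y : Euc n => 1 / 2 * Real.log (‖y‖ ^ 2)) =ᶠ[𝓝 x]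
        fun y => (fun s => cf n j * (s ^ (j + 1))⁻¹) (‖y‖ ^ 2) := by
      filter_upwards [isOpen_ne.mem_nhds hx] with y hy
      exact ih y hy
    rw [(lap_congr ev).eq_of_nhds]
    have hz : ∀ (N : ℕ) (s : ℝ), 0 < s → HasDerivAt (fun s : ℝ => (s ^ N)⁻¹) (-N * (s ^ (N + 1))⁻¹) s := by
      intro N s hs
      have := (hasDerivAt_pow N s).inv (by positivity)
      refine HasDerivAt.congr_deriv this ?_
      rcases N with _ | N
      · simp
      · simp only [Nat.add_sub_cancel]
        field_simp
        ring
    rw [lap_radial _ (fun s => cf n j * (-((j + 1 : ℕ) : ℝ) * (s ^ (j + 2))⁻¹))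
      (fun s => cf n j * (-((j + 1 : ℕ) : ℝ) * (-((j + 2 : ℕ):ℝ) * (s ^ (j + 3))⁻¹)))
      (fun s hs => (hz _ s hs).const_mul _)
      (fun s hs => ((hz _ s hs).const_mul _).const_mul _) x hx]
    simp only [cf]
    push_cast
    field_simp
    ring

lemma cf_val (m i : ℕ) (h : i + 2 ≤ m) :
    cf (2 * m) i * ((m - 2 - i).factorial : ℝ) =
      (-1) ^ i * 2 ^ (2 * i + 1) * i.factorial * (m - 1).factorial := by
  induction i with
  | zero =>
    obtain ⟨p, rfl⟩ := Nat.exists_eq_add_of_le' h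
    simp only [cf]
    rw [show p + (0 + 2) - 2 - 0 = p by omega, show p + (0 + 2) - 1 = p + 1 by omega,
      Nat.factorial_succ]
    push_cast
    simp
    ring
  | succ i ih =>
    have ih := ih (by omega)
    obtain ⟨p, rfl⟩ := Nat.exists_eq_add_of_le' h
    rw [show p + (i + 1 + 2) - 2 - i = p + 1 by omega, Nat.factorial_succ] at ih
    rw [show p + (i + 1 + 2) - 2 - (i + 1) = p by omega]
    simp only [cf]
    rw [Nat.factorial_succ i]
    push_cast at ih ⊢
    linear_combination (-2 * 2 * ((i : ℝ) + 1)) * ih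

lemma cf_sq (i : ℕ) : (cf (2 * (2 * i + 2)) i) ^ 2 = 4 ^ (2 * i + 1) * ((2 * i + 1).factorial : ℝ) ^ 2 := by
  have h := cf_val (2 * i + 2) i (by omega)
  rw [show 2 * i + 2 - 2 - i = i by omega, show 2 * i + 2 - 1 = 2 * i + 1 by omega] at h
  have hi : (i.factorial : ℝ) ≠ 0 := by positivity
  have h2 : cf (2 * (2 * i + 2)) i = (-1) ^ i * 2 ^ (2 * i + 1) * (2 * i + 1).factorial := by
    apply mul_right_cancel₀ hi
    rw [h]; ring
  rw [h2, mul_pow, mul_pow, ← pow_mul, mul_comm i 2, pow_mul, ← pow_mul 2, mul_comm (2 * i + 1) 2, pow_mul 2]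
  norm_num

lemma ibp {n : ℕ} {f g : Euc n → ℝ} (hf : ContDiff ℝ (⊤ : ℕ∞) f) (hg : ContDiff ℝ (⊤ : ℕ∞) g)
    (hgc : HasCompactSupport g) (v : Euc n) :
    ∫ x, f x * fderiv ℝ g x v = - ∫ x, fderiv ℝ f x v * g x := by
  apply integral_mul_fderiv_eq_neg_fderiv_mul_of_integrable
  · exact ((contDiff_pd hf v).continuous.mul hg.continuous).integrable_of_hasCompactSupport
      hgc.mul_left
  · exact (hf.continuous.mul (contDiff_pd hg v).continuous).integrable_of_hasCompactSupport
      (hgc.fderiv_apply ℝ v).mul_left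
  · exact (hf.continuous.mul hg.continuous).integrable_of_hasCompactSupport
      hgc.mul_left
  · exact fun x _ => hf.differentiable (by simp) x
  · exact fun x _ => hg.differentiable (by simp) x

lemma int_sq {n : ℕ} {f : Euc n → ℝ} (hf : Continuous f) (hfc : HasCompactSupport f) :
    Integrable (fun x => f x ^ 2) := by
  simp only [pow_two]
  exact (hf.mul hf).integrable_of_hasCompactSupport hfc.mul_left

lemma poincare1 {n : ℕ} {v : Euc n → ℝ} (hv : ContDiff ℝ (⊤ : ℕ∞) v) (hvc : HasCompactSupport v)
    {r : ℝ} (hr : tsupport v ⊆ Metric.closedBall 0 r) (i : Fin n) :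
    ∫ x, v x ^ 2 ≤ (2 * r) ^ 2 * ∫ x, (fderiv ℝ v x (EuclideanSpace.single i 1)) ^ 2 := by
  have h1 := ibp (f := fun x => (EuclideanSpace.proj (𝕜 := ℝ) i : Euc n →L[ℝ] ℝ) x)
    (g := fun x => v x * v x)
    (ContinuousLinearMap.contDiff _) (hv.mul hv) hvc.mul_left (EuclideanSpace.single i 1)
  have h2 : ∫ x, v x ^ 2 = ∫ x, (-2 * (x i) * v x * fderiv ℝ v x (EuclideanSpace.single i 1)) := by
    have e1 : ∀ x, fderiv ℝ (fun x : Euc n => (EuclideanSpace.proj (𝕜 := ℝ) i : Euc n →L[ℝ] ℝ) x) x (EuclideanSpace.single i 1) * (v x * v x)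
        = v x ^ 2 := by
      intro x
      rw [ContinuousLinearMap.fderiv]
      simp [pow_two]
    have e2 : ∀ x : Euc n, (EuclideanSpace.proj (𝕜 := ℝ) i : Euc n →L[ℝ] ℝ) x * fderiv ℝ (fun x => v x * v x) x (EuclideanSpace.single i 1)
        = -(-2 * (x i) * v x * fderiv ℝ v x (EuclideanSpace.single i 1)) := by
      intro x
      have hd : DifferentiableAt ℝ v x := hv.differentiable (by simp) x
      rw [fderiv_fun_mul hd hd]
      simp
      ring
    simp only [e1, e2, integral_neg] at h1
    linarith
  have i1 := int_sq hv.continuous hvc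
  have i2 := int_sq (contDiff_pd hv (EuclideanSpace.single i 1)).continuous (hvc.fderiv_apply ℝ _)
  have h3 : ∫ x, (-2 * (x i) * v x * fderiv ℝ v x (EuclideanSpace.single i 1)) ≤
      ∫ x, (1 / 2 * v x ^ 2 + 2 * r ^ 2 * (fderiv ℝ v x (EuclideanSpace.single i 1)) ^ 2) := by
    refine integral_mono ?_ ((i1.const_mul _).add (i2.const_mul _)) fun x => ?_
    · have c1 : Continuous (fun x : Euc n => x i) := by fun_prop
      exact (((continuous_const.mul c1).mul hv.continuous).mul
        (contDiff_pd hv _).continuous).integrable_of_hasCompactSupport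
        (hvc.fderiv_apply ℝ _).mul_left
    · simp only
      by_cases hx : x ∈ tsupport v
      · have hxr := hr hx
        rw [mem_closedBall_zero_iff] at hxr
        have hxi : |x i| ≤ r := by
          have := (PiLp.norm_apply_le x i).trans hxr
          simpa using this
        have hx2 : (x i) ^ 2 ≤ r ^ 2 := by
          rw [← sq_abs]; gcongr
        set d := fderiv ℝ v x (EuclideanSpace.single i 1)
        nlinarith [sq_nonneg (v x + 2 * x i * d), mul_le_mul_of_nonneg_right hx2 (sq_nonneg d)]
      · rw [image_eq_zero_of_notMem_tsupport hx]
        simp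
        positivity
  rw [integral_add (i1.const_mul _) (i2.const_mul _), integral_const_mul, integral_const_mul] at h3
  nlinarith

lemma poincare2 {n : ℕ} (hn : 0 < n) {v : Euc n → ℝ} (hv : ContDiff ℝ (⊤ : ℕ∞) v) (hvc : HasCompactSupport v)
    {r : ℝ} (hr : tsupport v ⊆ Metric.closedBall 0 r) :
    ∫ x, v x ^ 2 ≤ (2 * r) ^ 2 * ∫ x, ∑ i, (fderiv ℝ v x (EuclideanSpace.single i 1)) ^ 2 := by
  refine (poincare1 hv hvc hr ⟨0, hn⟩).trans ?_
  have i2 := fun i : Fin n => int_sq (contDiff_pd hv (EuclideanSpace.single i 1)).continuous (hvc.fderiv_apply ℝ _)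
  refine mul_le_mul_of_nonneg_left ?_ (by positivity)
  refine integral_mono (i2 _) (integrable_finsetSum _ fun i _ => i2 i) fun x => ?_
  exact Finset.single_le_sum (f := fun i => (fderiv ℝ v x (EuclideanSpace.single i 1)) ^ 2)
    (fun i _ => sq_nonneg _) (Finset.mem_univ (⟨0, hn⟩ : Fin n))

lemma poincare3 {n : ℕ} (hn : 0 < n) {v : Euc n → ℝ} (hv : ContDiff ℝ (⊤ : ℕ∞) v) (hvc : HasCompactSupport v)
    {r : ℝ} (hr0 : 0 < r) (hr : tsupport v ⊆ Metric.closedBall 0 r) :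
    ∫ x, ∑ i, (fderiv ℝ v x (EuclideanSpace.single i 1)) ^ 2 ≤ (2 * r) ^ 2 * ∫ x, lap n v x ^ 2 := by
  have i2 := fun i : Fin n => int_sq (contDiff_pd hv (EuclideanSpace.single i 1)).continuous (hvc.fderiv_apply ℝ _)
  have i1 := int_sq hv.continuous hvc
  have hlc : HasCompactSupport (lap n v) :=
    hvc.mono' ((subset_tsupport _).trans (tsupport_lapIter (u := v) 1))
  have i3 := int_sq (contDiff_lap hv).continuous hlc
  have h0 := poincare2 hn hv hvc hr
  have h1 : ∫ x, ∑ i, (fderiv ℝ v x (EuclideanSpace.single i 1)) ^ 2 = ∫ x, - (v x * lap n v x) := by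
    rw [integral_finsetSum _ fun i _ => i2 i, integral_neg]
    unfold lap
    simp only [Finset.mul_sum]
    rw [integral_finsetSum, ← Finset.sum_neg_distrib]
    · refine Finset.sum_congr rfl fun i _ => ?_
      rw [ibp hv (contDiff_pd hv _) (hvc.fderiv_apply ℝ _)]
      simp [pow_two]
    · intro i _
      exact (hv.continuous.mul (contDiff_pd (contDiff_pd hv _) _).continuous).integrable_of_hasCompactSupport
        hvc.mul_right
  have h3 : ∫ x, - (v x * lap n v x) ≤ ∫ x, (1 / (8 * r ^ 2) * v x ^ 2 + 2 * r ^ 2 * lap n v x ^ 2) := by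
    refine integral_mono ?_ ((i1.const_mul _).add (i3.const_mul _)) fun x => ?_
    · exact ((hv.continuous.mul (contDiff_lap hv).continuous).integrable_of_hasCompactSupport
        hvc.mul_right).neg
    · have : 0 ≤ (1 / (8 * r ^ 2)) * (v x + 4 * r ^ 2 * lap n v x) ^ 2 := by positivity
      have e : (1 / (8 * r ^ 2)) * (v x + 4 * r ^ 2 * lap n v x) ^ 2 =
        1 / (8 * r ^ 2) * v x ^ 2 + 2 * r ^ 2 * lap n v x ^ 2 + v x * lap n v x := by
        field_simp
        ring
      simp only
      linarith
  rw [integral_add (i1.const_mul _) (i3.const_mul _), integral_const_mul, integral_const_mul] at h3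
  have h4 := mul_le_mul_of_nonneg_left h0 (show 0 ≤ 1 / (8 * r ^ 2) by positivity)
  have e : ∀ A : ℝ, 1 / (8 * r ^ 2) * ((2 * r) ^ 2 * A) = A / 2 := by
    intro A; field_simp; ring
  rw [e] at h4
  nlinarith

lemma hasCompactSupport_lapIter {n : ℕ} {u : Euc n → ℝ} (huc : HasCompactSupport u) (k : ℕ) :
    HasCompactSupport (lapIter n k u) :=
  huc.mono' ((subset_tsupport _).trans (tsupport_lapIter (u := u) k))

lemma grad_integrable {n : ℕ} {u : Euc n → ℝ} (hu : ContDiff ℝ (⊤ : ℕ∞) u)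
    (huc : HasCompactSupport u) (γ : ℕ) : Integrable (gradNormSq n γ u) := by
  unfold gradNormSq
  have h1 := contDiff_lapIter hu (γ / 2)
  have h2 := hasCompactSupport_lapIter huc (γ / 2)
  by_cases h : γ % 2 = 0
  · simp only [h, if_true]
    exact int_sq h1.continuous h2
  · simp only [h, if_false]
    exact integrable_finsetSum _ fun i _ =>
      int_sq (contDiff_pd h1 _).continuous (h2.fderiv_apply ℝ _)

lemma grad_nonneg {n : ℕ} {u : Euc n → ℝ} (γ : ℕ) (x : Euc n) : 0 ≤ gradNormSq n γ u x := by
  unfold gradNormSq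
  split_ifs
  · positivity
  · exact Finset.sum_nonneg fun i _ => sq_nonneg _

lemma grad_step {n : ℕ} (hn : 0 < n) {u : Euc n → ℝ} (hu : ContDiff ℝ (⊤ : ℕ∞) u)
    (huc : HasCompactSupport u) {r : ℝ} (hr0 : 0 < r) (hr : tsupport u ⊆ Metric.closedBall 0 r)
    (γ : ℕ) : ∫ x, gradNormSq n γ u x ≤ (2 * r) ^ 2 * ∫ x, gradNormSq n (γ + 1) u x := by
  have h1 := contDiff_lapIter hu (γ / 2)
  have h2 := hasCompactSupport_lapIter huc (γ / 2)
  have h3 := (tsupport_lapIter (u := u) (γ / 2)).trans hr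
  unfold gradNormSq
  rcases Nat.mod_two_eq_zero_or_one γ with h | h
  · have h' : ¬ ((γ + 1) % 2 = 0) := by omega
    have h'' : (γ + 1) / 2 = γ / 2 := by omega
    simp only [h, h', h'', if_true, if_false]
    exact poincare2 hn h1 h2 h3
  · have h' : ((γ + 1) % 2 = 0) := by omega
    have h'' : (γ + 1) / 2 = γ / 2 + 1 := by omega
    simp only [h, h', h'', if_true]
    exact poincare3 hn h1 h2 hr0 h3

lemma grad_all {n : ℕ} (hn : 0 < n) {u : Euc n → ℝ} (hu : ContDiff ℝ (⊤ : ℕ∞) u)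
    (huc : HasCompactSupport u) {r : ℝ} (hr0 : 0 < r) (hr1 : 2 * r ≤ 1)
    (hr : tsupport u ⊆ Metric.closedBall 0 r)
    (γ d : ℕ) : ∫ x, gradNormSq n γ u x ≤ (2 * r) ^ 2 * ∫ x, gradNormSq n (γ + d + 1) u x := by
  induction d with
  | zero => exact grad_step hn hu huc hr0 hr γ
  | succ d ih =>
    refine ih.trans (mul_le_mul_of_nonneg_left ?_ (by positivity))
    refine (grad_step hn hu huc hr0 hr _).trans ?_
    have : 0 ≤ ∫ x, gradNormSq n (γ + d + 1 + 1) u x := integral_nonneg fun x => grad_nonneg _ _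
    have h4 : (2 * r) ^ 2 ≤ 1 := by nlinarith
    rw [show γ + (d + 1) + 1 = γ + d + 1 + 1 by ring]
    nlinarith

lemma energy_total {n : ℕ} (hn : 0 < n) {u : Euc n → ℝ} (hu : ContDiff ℝ (⊤ : ℕ∞) u)
    (huc : HasCompactSupport u) {r : ℝ} (hr0 : 0 < r) (hr1 : 2 * r ≤ 1)
    (hr : tsupport u ⊆ Metric.closedBall 0 r) (k : ℕ) (τ : ℕ → ℝ) (hτ : ∀ γ < 2 * k, 0 < τ γ)
    (hτm : τ (2 * k) = 1) :
    ∫ x, ∑ γ ∈ Finset.range (2 * k + 1), τ γ * gradNormSq n γ u x ≤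
      (1 + (2 * r) ^ 2 * ∑ γ ∈ Finset.range (2 * k), τ γ) * ∫ x, lapIter n k u x ^ 2 := by
  rw [integral_finsetSum _ fun γ _ => (grad_integrable hu huc γ).const_mul _]
  simp only [integral_const_mul]
  have e : ∫ x, gradNormSq n (2 * k) u x = ∫ x, lapIter n k u x ^ 2 := by
    unfold gradNormSq
    simp
  rw [Finset.sum_range_succ, hτm, e, add_mul, one_mul, add_comm, mul_assoc, Finset.sum_mul,
    Finset.mul_sum]
  refine add_le_add le_rfl (Finset.sum_le_sum fun γ hγ => ?_)
  rw [Finset.mem_range] at hγ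
  have h := grad_all hn hu huc hr0 hr1 hr γ (2 * k - 1 - γ)
  rw [show γ + (2 * k - 1 - γ) + 1 = 2 * k by omega, e] at h
  have := mul_le_mul_of_nonneg_left h (hτ γ hγ).le
  linarith

lemma exists_G (n i : ℕ) : ∃ (G : Euc n → ℝ) (M0 M1 : ℝ), ContDiff ℝ (⊤ : ℕ∞) G ∧
    (∀ x, 1 ≤ ‖x‖ → G x = Real.log ‖x‖) ∧ (∀ x, ‖x‖ ≤ 1 → |G x| ≤ M0) ∧
    (∀ x, |lapIter n (i + 1) G x| ≤ M1) ∧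
    (∀ x, 1 ≤ ‖x‖ → lapIter n (i + 1) G x = cf n i * ((‖x‖ ^ 2) ^ (i + 1))⁻¹) := by
  let b : ContDiffBump (0 : Euc n) := ⟨1 / 4, 1 / 2, by norm_num, by norm_num⟩
  let G : Euc n → ℝ := fun x => 1 / 2 * Real.log (‖x‖ ^ 2 + b x)
  have hpos : ∀ x : Euc n, ‖x‖ ^ 2 + b x ≠ 0 := by
    intro x
    by_cases hx : x = 0
    · subst hx
      have : b (0 : Euc n) = 1 := b.one_of_mem_closedBall (by simp; norm_num [b])
      simp [this]
    · have : 0 ≤ b x := b.nonneg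
      have h2 : 0 < ‖x‖ ^ 2 := by positivity
      linarith
  have hG : ContDiff ℝ (⊤ : ℕ∞) G :=
    contDiff_const.mul (ContDiff.log ((contDiff_norm_sq ℝ).add b.contDiff) hpos)
  have hout : ∀ x : Euc n, 1 / 2 < ‖x‖ → G x = 1 / 2 * Real.log (‖x‖ ^ 2) := by
    intro x hx
    have : b x = 0 := b.zero_of_le_dist (by simpa [b] using hx.le)
    simp [G, this]
  have hlap : ∀ x : Euc n, 1 ≤ ‖x‖ → lapIter n (i + 1) G x = cf n i * ((‖x‖ ^ 2) ^ (i + 1))⁻¹ := by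
    intro x hx
    have hx0 : x ≠ 0 := by rintro rfl; norm_num at hx
    rw [← lapIter_log i x hx0]
    refine (lapIter_congr ?_ (i + 1)).eq_of_nhds
    have : {y : Euc n | 1 / 2 < ‖y‖} ∈ 𝓝 x :=
      (isOpen_lt continuous_const continuous_norm).mem_nhds (by simp only [Set.mem_ofPred_eq]; linarith)
    filter_upwards [this] with y hy using hout y hy
  obtain ⟨M0, hM0⟩ := (isCompact_closedBall (0 : Euc n) 1).exists_bound_of_continuousOn
    hG.continuous.continuousOn
  obtain ⟨M1, hM1⟩ := (isCompact_closedBall (0 : Euc n) 1).exists_bound_of_continuousOn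
    (contDiff_lapIter hG (i + 1)).continuous.continuousOn
  refine ⟨G, M0, max M1 |cf n i|, hG, ?_, ?_, ?_, hlap⟩
  · intro x hx
    rw [hout x (by linarith), Real.log_pow]
    push_cast
    ring
  · intro x hx
    exact hM0 x (by simpa using hx)
  · intro x
    rcases le_total ‖x‖ 1 with h | h
    · exact (hM1 x (by simpa using h)).trans (le_max_left _ _)
    · rw [hlap x h, abs_mul]
      refine le_trans ?_ (le_max_right _ _)
      have h1 : 1 ≤ (‖x‖ ^ 2) ^ (i + 1) := one_le_pow₀ (one_le_pow₀ h)
      rw [abs_of_nonneg (by positivity : 0 ≤ ((‖x‖ ^ 2) ^ (i + 1))⁻¹)]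
      exact mul_le_of_le_one_right (abs_nonneg _) (inv_le_one_of_one_le₀ h1)

lemma ann_integral (n : ℕ) (hn : 0 < n) {p q : ℝ} (hp : 0 < p) (hpq : p ≤ q) :
    Integrable (fun x : Euc n => (Set.Ioc p q).indicator (fun t : ℝ => (t ^ n)⁻¹) ‖x‖) ∧
    ∫ x : Euc n, (Set.Ioc p q).indicator (fun t : ℝ => (t ^ n)⁻¹) ‖x‖ =
      n * volume.real (Metric.ball (0 : Euc n) 1) * (Real.log q - Real.log p) := by
  have : Nontrivial (Euc n) := by
    have : Nonempty (Fin n) := ⟨⟨0, hn⟩⟩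
    infer_instance
  have hfun : ∀ y : ℝ, y ^ (n - 1) • (Set.Ioc p q).indicator (fun t : ℝ => (t ^ n)⁻¹) y =
      (Set.Ioc p q).indicator (fun t : ℝ => t⁻¹) y := by
    intro y
    by_cases hy : y ∈ Set.Ioc p q
    · have hy0 : y ≠ 0 := (hp.trans hy.1).ne'
      simp only [Set.indicator_of_mem hy, smul_eq_mul]
      obtain ⟨N, rfl⟩ : ∃ N, n = N + 1 := ⟨n - 1, by omega⟩
      simp only [Nat.add_sub_cancel]
      field_simp
      ring
    · simp [Set.indicator_of_notMem hy]
  have hsub : Set.Ioc p q ∩ Set.Ioi 0 = Set.Ioc p q := by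
    apply Set.inter_eq_left.2
    exact fun y hy => hp.trans hy.1
  constructor
  · rw [integrable_fun_norm_addHaar volume, finrank_euclideanSpace_fin]
    simp only [hfun]
    apply Integrable.integrableOn
    rw [integrable_indicator_iff measurableSet_Ioc]
    rw [← intervalIntegrable_iff_integrableOn_Ioc_of_le hpq]
    apply intervalIntegral.intervalIntegrable_inv
    · intro x hx
      rw [Set.uIcc_of_le hpq] at hx
      exact (hp.trans_le hx.1).ne'
    · exact continuousOn_id
  · rw [integral_fun_norm_addHaar volume, finrank_euclideanSpace_fin]
    simp only [hfun]
    rw [integral_indicator measurableSet_Ioc, Measure.restrict_restrict measurableSet_Ioc, hsub,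
      ← intervalIntegral.integral_of_le hpq, integral_inv_of_pos hp (hp.trans_le hpq),
      Real.log_div (hp.trans_le hpq).ne' hp.ne']
    simp [mul_assoc]

lemma ball_integral (n : ℕ) {a : ℝ} (ha : 0 < a) (K : ℝ) :
    Integrable ((Metric.closedBall (0 : Euc n) a⁻¹).indicator (fun _ => a ^ n * K)) ∧
    ∫ x : Euc n, (Metric.closedBall (0 : Euc n) a⁻¹).indicator (fun _ => a ^ n * K) x =
      K * volume.real (Metric.ball (0 : Euc n) 1) := by
  constructor
  · rw [integrable_indicator_iff Metric.isClosed_closedBall.measurableSet]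
    exact integrableOn_const (isCompact_closedBall _ _).measure_lt_top.ne
  · rw [integral_indicator_const _ Metric.isClosed_closedBall.measurableSet,
      Measure.addHaar_real_closedBall _ _ (by positivity), finrank_euclideanSpace_fin]
    simp
    field_simp

/-- test function -/
def wf {n : ℕ} (G : Euc n → ℝ) (a b : ℝ) : Euc n → ℝ :=
  fun x => ((Real.log b - Real.log a) + G (a • x)) + (-1) * G (b • x)

lemma wf_smooth {n : ℕ} {G : Euc n → ℝ} (hG : ContDiff ℝ (⊤ : ℕ∞) G) (a b : ℝ) :
    ContDiff ℝ (⊤ : ℕ∞) (wf G a b) := by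
  unfold wf
  have h : ∀ c : ℝ, ContDiff ℝ (⊤ : ℕ∞) (fun x => G (c • x)) :=
    fun c => hG.comp (contDiff_id.const_smul c)
  exact (contDiff_const.add (h a)).add (contDiff_const.mul (h b))

lemma wf_lap {n : ℕ} {G : Euc n → ℝ} (hG : ContDiff ℝ (⊤ : ℕ∞) G) (a b : ℝ) (i : ℕ) (x : Euc n) :
    lapIter n (i + 1) (wf G a b) x = a ^ (2 * (i + 1)) * lapIter n (i + 1) G (a • x)
      - b ^ (2 * (i + 1)) * lapIter n (i + 1) G (b • x) := by
  have h : ∀ c : ℝ, ContDiff ℝ (⊤ : ℕ∞) (fun x => G (c • x)) :=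
    fun c => hG.comp (contDiff_id.const_smul c)
  unfold wf
  rw [lapIter_add (contDiff_const.add (h a)) (contDiff_const.mul (h b)),
    lapIter_add contDiff_const (h a), lapIter_const, lapIter_const_mul, lapIter_comp_smul,
    lapIter_comp_smul]
  ring

lemma wf_tsupport {n : ℕ} {G : Euc n → ℝ} (h1 : ∀ x, 1 ≤ ‖x‖ → G x = Real.log ‖x‖)
    {a b : ℝ} (ha : 0 < a) (hab : a ≤ b) : tsupport (wf G a b) ⊆ Metric.closedBall 0 a⁻¹ := by
  apply closure_minimal _ Metric.isClosed_closedBall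
  intro x hx
  by_contra hxa
  apply hx
  simp only [mem_closedBall_zero_iff, not_le] at hxa
  have hb := ha.trans_le hab
  have hx0 : 0 < ‖x‖ := (inv_pos.2 ha).trans hxa
  have e1 : ‖a • x‖ = a * ‖x‖ := by rw [norm_smul, Real.norm_of_nonneg ha.le]
  have e2 : ‖b • x‖ = b * ‖x‖ := by rw [norm_smul, Real.norm_of_nonneg hb.le]
  have l1 : 1 ≤ a * ‖x‖ := by
    rw [inv_lt_iff_one_lt_mul₀ ha, mul_comm] at hxa; exact hxa.le
  have l2 : 1 ≤ b * ‖x‖ := l1.trans (by gcongr)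
  unfold wf
  rw [h1 _ (by rw [e1]; exact l1), h1 _ (by rw [e2]; exact l2), e1, e2,
    Real.log_mul ha.ne' hx0.ne', Real.log_mul hb.ne' hx0.ne']
  ring

lemma wf_lower {n : ℕ} {G : Euc n → ℝ} {M0 : ℝ} (h2 : ∀ x, ‖x‖ ≤ 1 → |G x| ≤ M0)
    {a b : ℝ} (ha : 0 < a) (hab : a ≤ b) (x : Euc n) (hx : ‖x‖ ≤ b⁻¹) :
    (Real.log b - Real.log a) - 2 * M0 ≤ wf G a b x := by
  have hb := ha.trans_le hab
  have e1 : ‖a • x‖ = a * ‖x‖ := by rw [norm_smul, Real.norm_of_nonneg ha.le]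
  have e2 : ‖b • x‖ = b * ‖x‖ := by rw [norm_smul, Real.norm_of_nonneg hb.le]
  have l2 : b * ‖x‖ ≤ 1 := by
    calc b * ‖x‖ ≤ b * b⁻¹ := by gcongr
      _ = 1 := mul_inv_cancel₀ hb.ne'
  have l1 : a * ‖x‖ ≤ 1 := le_trans (by gcongr) l2
  have g1 := abs_le.1 (h2 (a • x) (by rw [e1]; exact l1))
  have g2 := abs_le.1 (h2 (b • x) (by rw [e2]; exact l2))
  unfold wf
  linarith [g1.1, g2.2]

lemma wf_energy (i : ℕ) {n : ℕ} (hn : n = 4 * (i + 1)) {G : Euc n → ℝ} {M1 : ℝ}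
    (hG : ContDiff ℝ (⊤ : ℕ∞) G)
    (h1 : ∀ x, 1 ≤ ‖x‖ → G x = Real.log ‖x‖)
    (h3 : ∀ x, |lapIter n (i + 1) G x| ≤ M1)
    (h4 : ∀ x, 1 ≤ ‖x‖ → lapIter n (i + 1) G x = cf n i * ((‖x‖ ^ 2) ^ (i + 1))⁻¹)
    {a b δ : ℝ} (ha : 0 < a) (hab : a ≤ b) (hδ : 0 < δ) :
    ∫ x, lapIter n (i + 1) (wf G a b) x ^ 2 ≤
      (4 * M1 ^ 2) * volume.real (Metric.ball (0 : Euc n) 1) +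
      ((1 + δ⁻¹) * M1 ^ 2) * volume.real (Metric.ball (0 : Euc n) 1) +
      ((1 + δ) * cf n i ^ 2) * (n * volume.real (Metric.ball (0 : Euc n) 1) * (Real.log b - Real.log a)) := by
  have hb := ha.trans_le hab
  have hM1 : 0 ≤ M1 := (abs_nonneg _).trans (h3 0)
  have hinv : b⁻¹ ≤ a⁻¹ := by gcongr
  obtain ⟨iA, eA⟩ := ann_integral n (by omega) (inv_pos.2 hb) hinv
  obtain ⟨iB, eB⟩ := ball_integral n hb (4 * M1 ^ 2)
  obtain ⟨iC, eC⟩ := ball_integral n ha ((1 + δ⁻¹) * M1 ^ 2)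
  have hlog : Real.log a⁻¹ - Real.log b⁻¹ = Real.log b - Real.log a := by
    rw [Real.log_inv, Real.log_inv]; ring
  rw [hlog] at eA
  have iBC : Integrable (fun x => (Metric.closedBall (0 : Euc n) b⁻¹).indicator
      (fun _ => b ^ n * (4 * M1 ^ 2)) x + (Metric.closedBall (0 : Euc n) a⁻¹).indicator
      (fun _ => a ^ n * ((1 + δ⁻¹) * M1 ^ 2)) x) := iB.add iC
  rw [← eA, ← eB, ← eC, ← integral_const_mul, ← integral_add iB iC,
    ← integral_add iBC (iA.const_mul _)]
  have hsm := wf_smooth hG a b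
  have hts := wf_tsupport h1 ha hab
  have hcs : HasCompactSupport (wf G a b) :=
    HasCompactSupport.of_support_subset_isCompact (isCompact_closedBall 0 a⁻¹)
      ((subset_tsupport _).trans hts)
  refine integral_mono (int_sq (contDiff_lapIter hsm _).continuous (hasCompactSupport_lapIter hcs _))
    (iBC.add (iA.const_mul _)) fun x => ?_
  simp only
  have n1 : 0 ≤ (Metric.closedBall (0 : Euc n) b⁻¹).indicator (fun _ => b ^ n * (4 * M1 ^ 2)) x :=
    Set.indicator_nonneg (fun _ _ => by positivity) x
  have n2 : 0 ≤ (Metric.closedBall (0 : Euc n) a⁻¹).indicator (fun _ => a ^ n * ((1 + δ⁻¹) * M1 ^ 2)) x :=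
    Set.indicator_nonneg (fun _ _ => by positivity) x
  have n3 : 0 ≤ (1 + δ) * cf n i ^ 2 * (Set.Ioc b⁻¹ a⁻¹).indicator (fun t : ℝ => (t ^ n)⁻¹) ‖x‖ := by
    refine mul_nonneg (by positivity) (Set.indicator_nonneg (fun t ht => ?_) _)
    have : 0 < t := (inv_pos.2 hb).trans ht.1
    positivity
  have hpow : ∀ c : ℝ, (c ^ (2 * (i + 1))) ^ 2 = c ^ n := by
    intro c; rw [← pow_mul, hn]; congr 1; ring
  by_cases hxa : ‖x‖ ≤ a⁻¹
  · by_cases hxb : ‖x‖ ≤ b⁻¹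
    · have e : (lapIter n (i + 1) (wf G a b) x) ^ 2 ≤ b ^ n * (4 * M1 ^ 2) := by
        have : |lapIter n (i + 1) (wf G a b) x| ≤ 2 * b ^ (2 * (i + 1)) * M1 := by
          rw [wf_lap hG]
          refine (abs_sub _ _).trans ?_
          rw [abs_mul, abs_mul, abs_of_nonneg (by positivity : 0 ≤ a ^ (2 * (i + 1))),
            abs_of_nonneg (by positivity : 0 ≤ b ^ (2 * (i + 1)))]
          have q1 : a ^ (2 * (i + 1)) * |lapIter n (i + 1) G (a • x)| ≤ b ^ (2 * (i + 1)) * M1 := by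
            gcongr; exact h3 _
          have q2 : b ^ (2 * (i + 1)) * |lapIter n (i + 1) G (b • x)| ≤ b ^ (2 * (i + 1)) * M1 := by
            gcongr; exact h3 _
          linarith
        rw [← sq_abs]
        calc |lapIter n (i + 1) (wf G a b) x| ^ 2 ≤ (2 * b ^ (2 * (i + 1)) * M1) ^ 2 := by gcongr
          _ = b ^ n * (4 * M1 ^ 2) := by rw [← hpow b]; ring
      rw [Set.indicator_of_mem (by simpa using hxb)]
      linarith
    · push Not at hxb
      have hx0 : 0 < ‖x‖ := (inv_pos.2 hb).trans hxb
      have hbx : 1 ≤ ‖b • x‖ := by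
        rw [norm_smul, Real.norm_of_nonneg hb.le]
        have := (inv_lt_iff_one_lt_mul₀ hb).1 hxb; linarith
      have e : lapIter n (i + 1) (wf G a b) x =
          a ^ (2 * (i + 1)) * lapIter n (i + 1) G (a • x) - cf n i * (‖x‖ ^ (2 * (i + 1)))⁻¹ := by
        rw [wf_lap hG, h4 _ hbx, norm_smul, Real.norm_of_nonneg hb.le, ← pow_mul, mul_pow]
        field_simp
      have e' : (lapIter n (i + 1) (wf G a b) x) ^ 2 ≤ a ^ n * ((1 + δ⁻¹) * M1 ^ 2) +
          (1 + δ) * cf n i ^ 2 * (‖x‖ ^ n)⁻¹ := by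
        rw [e, ← hpow a, ← hpow ‖x‖]
        set A := a ^ (2 * (i + 1))
        set F := lapIter n (i + 1) G (a • x)
        set c := cf n i
        set X := (‖x‖ ^ (2 * (i + 1)))⁻¹ with hX
        rw [← inv_pow, ← hX]
        have hF : F ^ 2 ≤ M1 ^ 2 := by rw [← sq_abs]; gcongr; exact h3 _
        have hF2 : A ^ 2 * ((1 + δ⁻¹) * F ^ 2) ≤ A ^ 2 * ((1 + δ⁻¹) * M1 ^ 2) := by gcongr
        have hs : 0 ≤ δ⁻¹ * (A * F + δ * (c * X)) ^ 2 := by positivity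
        have hs2 : δ⁻¹ * (A * F + δ * (c * X)) ^ 2 = δ⁻¹ * (A * F) ^ 2 + 2 * (A * F) * (c * X) +
            δ * (c * X) ^ 2 := by
          field_simp
          ring
        nlinarith
      rw [Set.indicator_of_mem (show x ∈ Metric.closedBall (0 : Euc n) a⁻¹ by simpa using hxa),
        Set.indicator_of_mem (show ‖x‖ ∈ Set.Ioc b⁻¹ a⁻¹ from ⟨hxb, hxa⟩)]
      linarith
  · have : lapIter n (i + 1) (wf G a b) x = 0 := by
      apply image_eq_zero_of_notMem_tsupport
      intro hx
      exact hxa (by simpa using hts (tsupport_lapIter _ hx))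
    rw [this]
    nlinarith

lemma sing_lower {n : ℕ} (hn : 0 < n) {u : Euc n → ℝ} (hu : Continuous u)
    (huc : HasCompactSupport u) {α β b T : ℝ} (hα : 0 ≤ α) (hβ0 : 0 ≤ β) (hβ : β < n) (hb : 0 < b)
    (hT : 0 ≤ T) (h : ∀ x, ‖x‖ ≤ b⁻¹ → T ≤ α * u x ^ 2) :
    (Real.exp T - 1) * b ^ (β - n) * volume.real (Metric.ball (0 : Euc n) 1) ≤
      ∫ x, (Real.exp (α * (u x) ^ 2) - 1) / ‖x‖ ^ β := by
  obtain ⟨iB, eB⟩ := ball_integral n hb ((Real.exp T - 1) * b ^ (β - n))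
  rw [← eB]
  have : Nontrivial (Euc n) := by
    have : Nonempty (Fin n) := ⟨⟨0, hn⟩⟩
    infer_instance
  have hli : LocallyIntegrable (fun x : Euc n => (‖x‖ ^ β)⁻¹) := by
    refine locallyIntegrable_of_norm_le_rpow (C := 1) (α := β) ?_ ?_ ?_ ?_
    · rw [finrank_euclideanSpace_fin]; omega
    · rw [finrank_euclideanSpace_fin]; exact hβ
    · refine Eventually.of_forall fun x => ?_
      rw [Real.rpow_neg (norm_nonneg _), one_mul, Real.norm_of_nonneg (by positivity)]
    · exact (measurable_norm.pow_const β).inv.aestronglyMeasurable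
  have hint : Integrable (fun x : Euc n => (Real.exp (α * (u x) ^ 2) - 1) / ‖x‖ ^ β) := by
    have := hli.integrable_smul_left_of_hasCompactSupport
      (g := fun x => Real.exp (α * (u x) ^ 2) - 1) (by fun_prop)
      (huc.comp_left (g := fun t => Real.exp (α * t ^ 2) - 1) (by simp))
    simpa [div_eq_mul_inv] using this
  refine integral_mono_ae iB hint ?_
  have hne : ∀ᵐ x : Euc n, x ≠ 0 := by
    simp [ae_iff]
  filter_upwards [hne] with x hx
  have hx0 : 0 < ‖x‖ := norm_pos_iff.2 hx
  by_cases hxb : ‖x‖ ≤ b⁻¹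
  · rw [Set.indicator_of_mem (by simpa using hxb)]
    have e : b ^ n * ((Real.exp T - 1) * b ^ (β - n)) = (Real.exp T - 1) * b ^ β := by
      rw [Real.rpow_sub hb, Real.rpow_natCast]
      field_simp
    rw [e, div_eq_mul_inv]
    have h1 : 1 ≤ Real.exp T := Real.one_le_exp hT
    have h2 : b ^ β ≤ (‖x‖ ^ β)⁻¹ := by
      rw [← Real.inv_rpow hx0.le]
      apply Real.rpow_le_rpow hb.le _ hβ0
      rw [le_inv_comm₀ hb hx0]; exact hxb
    have h3 := Real.exp_le_exp.2 (h x hxb)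
    gcongr
    linarith
  · rw [Set.indicator_of_notMem (by simpa using hxb)]
    have h1 : 1 ≤ Real.exp (α * u x ^ 2) := Real.one_le_exp (by positivity)
    have : 0 ≤ Real.exp (α * u x ^ 2) - 1 := by linarith
    positivity

lemma vol_ball (m : ℕ) (hm : 0 < m) :
    volume.real (Metric.ball (0 : Euc (2 * m)) 1) = π ^ m / m.factorial := by
  have : Nontrivial (Euc (2 * m)) := by
    have : Nonempty (Fin (2 * m)) := ⟨⟨0, by omega⟩⟩
    infer_instance
  rw [Measure.real, InnerProductSpace.volume_ball_of_dim_even (k := m) (by simp)]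
  simp
  positivity

set_option maxHeartbeats 1000000 in
/-- Sharpness of the singular Adams-type inequality (Theorem 1.1). -/
theorem singular_adams_sharp (m : ℕ) (hm : 2 ≤ m) (hme : Even m)
    (τ : ℕ → ℝ) (hτ : ∀ γ < m, 0 < τ γ) (hτm : τ m = 1)
    (β : ℝ) (hβ0 : 0 ≤ β) (hβ : β < 2*m)
    (α : ℝ) (hα : (1 - β/(2*m)) * ((4*π)^m * (m.factorial : ℝ)) < α) :
    ∀ C : ℝ, 0 < C → ∃ u : Euc (2*m) → ℝ, ContDiff ℝ (⊤ : ℕ∞) u ∧ HasCompactSupport u ∧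
      (∫ x, ∑ γ ∈ Finset.range (m+1), τ γ * gradNormSq (2*m) γ u x) ≤ 1 ∧
      C < ∫ x, (Real.exp (α * (u x)^2) - 1) / ‖x‖ ^ β := by
  intro C hC
  obtain ⟨i, rfl⟩ : ∃ i, m = 2 * (i + 1) := by
    obtain ⟨j, rfl⟩ := hme
    exact ⟨j - 1, by omega⟩
  have hV := vol_ball (2 * (i + 1)) (by omega)
  have hn4 : 2 * (2 * (i + 1)) = 4 * (i + 1) := by ring
  have hcf : cf (2 * (2 * (i + 1))) i ^ 2 = 4 ^ (2 * i + 1) * ((2 * i + 1).factorial : ℝ) ^ 2 := cf_sq i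
  have hnpos : 0 < 2 * (2 * (i + 1)) := by omega
  have hnr : ((2 * (2 * (i + 1)) : ℕ) : ℝ) = 2 * ((2 * (i + 1) : ℕ) : ℝ) := by push_cast; ring
  have hK : (4 * π) ^ (2 * (i + 1)) * ((2 * (i + 1)).factorial : ℝ) =
      ((2 * (2 * (i + 1)) : ℕ) : ℝ) * (cf (2 * (2 * (i + 1))) i ^ 2 *
        (((2 * (2 * (i + 1)) : ℕ) : ℝ) * volume.real (Metric.ball (0 : Euc (2 * (2 * (i + 1)))) 1))) := by
    rw [hV, hcf, show 2 * (i + 1) = 2 * i + 1 + 1 by ring, Nat.factorial_succ (2 * i + 1)]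
    push_cast
    field_simp
    ring
  obtain ⟨G, M0, M1, hG, h1, h2, h3, h4⟩ := exists_G (2 * (2 * (i + 1))) i
  rw [hK] at hα
  rw [← hnr] at hα hβ
  have hVpos : 0 < volume.real (Metric.ball (0 : Euc (2 * (2 * (i + 1)))) 1) := by
    rw [hV]; positivity
  have hcfpos : 0 < cf (2 * (2 * (i + 1))) i ^ 2 := by rw [hcf]; positivity
  have hM0 : 0 ≤ M0 := (abs_nonneg _).trans (h2 0 (by simp))
  clear hK hV hcf hm hnr
  generalize hm2 : 2 * (i + 1) = m at *
  generalize hN : 2 * m = n at *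
  set V := volume.real (Metric.ball (0 : Euc n) 1)
  set c2 := cf n i ^ 2
  have hn' : (0 : ℝ) < n := by exact_mod_cast hnpos
  obtain ⟨A0, hA0⟩ : ∃ A0, A0 = c2 * (n * V) := ⟨_, rfl⟩
  have hA0pos : 0 < A0 := by rw [hA0]; positivity
  have hα1 : (n - β) * A0 < α := by
    rw [← hA0] at hα
    have : (1 - β / n) * (n * A0) = (n - β) * A0 := by field_simp
    linarith
  have hα0 : 0 < α := lt_of_le_of_lt (mul_nonneg (by linarith) hA0pos.le) hα1
  obtain ⟨δ, hδ, hδα⟩ : ∃ δ : ℝ, 0 < δ ∧ (n - β + δ) * ((1 + δ) ^ 2 * A0) < α := by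
    have hc : ContinuousAt (fun δ : ℝ => (n - β + δ) * ((1 + δ) ^ 2 * A0)) 0 := by fun_prop
    have h0 : (fun δ : ℝ => (n - β + δ) * ((1 + δ) ^ 2 * A0)) 0 < α := by simpa using hα1
    have ev := (hc.eventually_lt continuousAt_const h0).filter_mono (nhdsWithin_le_nhds (s := Set.Ioi 0))
    obtain ⟨δ, hd, hd2⟩ := (ev.and self_mem_nhdsWithin).exists
    exact ⟨δ, hd2, hd⟩
  set S := ∑ γ ∈ Finset.range m, τ γ with hS
  have hS0 : 0 ≤ S := Finset.sum_nonneg fun γ hγ => (hτ γ (Finset.mem_range.1 hγ)).le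
  obtain ⟨a, ha2, haS⟩ : ∃ a : ℝ, 2 ≤ a ∧ (2 * a⁻¹) ^ 2 * S ≤ δ := by
    refine ⟨2 + 4 * S / δ, by linarith [show 0 ≤ 4 * S / δ by positivity], ?_⟩
    set a := 2 + 4 * S / δ with ha
    have hS' : 0 ≤ 4 * S / δ := by positivity
    have ha2 : 2 ≤ a := by linarith
    have : 4 * S ≤ δ * a := by
      rw [ha, mul_add, mul_div_cancel₀ _ hδ.ne']
      linarith
    have e : (2 * a⁻¹) ^ 2 * S = 4 * S / a ^ 2 := by field_simp; ring
    rw [e, div_le_iff₀ (by positivity)]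
    nlinarith [mul_le_mul_of_nonneg_left ha2 hδ.le, mul_pos hδ (by linarith : 0 < a)]
  have ha : 0 < a := by linarith
  set q := n - β + δ with hq
  have hq0 : 0 < q := by linarith
  set A := (1 + δ) ^ 2 * A0 with hA
  obtain ⟨B, hB⟩ : ∃ B, B = (1 + δ) * ((4 * M1 ^ 2) * V + ((1 + δ⁻¹) * M1 ^ 2) * V) := ⟨_, rfl⟩
  have hB0 : 0 ≤ B := by rw [hB]; positivity
  have hA1 : 0 < A := by positivity
  have hgap : 0 < α - q * A := by linarith
  have hP : 0 < a ^ (β - n) * δ * V := by positivity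
  obtain ⟨L, hL1, hL2, hL3, hL4⟩ : ∃ L : ℝ, 1 ≤ L ∧ 2 * M0 ≤ L ∧ 4 * α * M0 + q * B ≤ (α - q * A) * L ∧
      C < a ^ (β - n) * δ * V * L := by
    have e1 := eventually_ge_atTop (1 : ℝ)
    have e2 := eventually_ge_atTop (2 * M0)
    have e3 := (tendsto_id.const_mul_atTop hgap).eventually_ge_atTop (4 * α * M0 + q * B)
    have e4 := (tendsto_id.const_mul_atTop hP).eventually_gt_atTop C
    obtain ⟨L, ⟨⟨l1, l2⟩, l3⟩, l4⟩ := (((e1.and e2).and e3).and e4).exists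
    exact ⟨L, l1, l2, l3, l4⟩
  have hL0 : 0 < L := by linarith
  set b := a * Real.exp L with hb
  have hb0 : 0 < b := by positivity
  have hab : a ≤ b := le_mul_of_one_le_right ha.le (Real.one_le_exp hL0.le)
  have hlog : Real.log b - Real.log a = L := by
    rw [hb, Real.log_mul ha.ne' (Real.exp_pos _).ne', Real.log_exp]; ring
  have hsm := wf_smooth hG a b
  have hts := wf_tsupport h1 ha hab
  have hE := wf_energy i hn4 hG h1 h3 h4 ha hab hδ
  have hlow := fun x hx => wf_lower h2 ha hab x hx
  rw [hlog] at hE hlow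
  set w := wf G a b
  obtain ⟨D, hD⟩ : ∃ D, D = A * L + B := ⟨_, rfl⟩
  have hD0 : 0 < D := by rw [hD]; positivity
  have hsq : (√D)⁻¹ ^ 2 = D⁻¹ := by rw [inv_pow, Real.sq_sqrt hD0.le]
  have husm : ContDiff ℝ (⊤ : ℕ∞) (fun x => (√D)⁻¹ * w x) := contDiff_const.mul hsm
  have huts : tsupport (fun x => (√D)⁻¹ * w x) ⊆ Metric.closedBall 0 a⁻¹ :=
    (tsupport_mul_subset_right (f := fun _ => (√D)⁻¹) (g := w)).trans hts
  have hucs : HasCompactSupport (fun x => (√D)⁻¹ * w x) :=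
    HasCompactSupport.of_support_subset_isCompact (isCompact_closedBall 0 a⁻¹)
      ((subset_tsupport _).trans huts)
  refine ⟨fun x => (√D)⁻¹ * w x, husm, hucs, ?_, ?_⟩
  · subst hm2
    have hr1 : 2 * a⁻¹ ≤ 1 := by
      rw [← div_eq_mul_inv, div_le_one ha]; exact ha2
    have hT := energy_total hnpos husm hucs (inv_pos.2 ha) hr1 huts (i + 1) τ hτ hτm
    refine hT.trans ?_
    rw [← hS, lapIter_const_mul]
    simp only [mul_pow, integral_const_mul]
    rw [hsq]
    have hE0 : 0 ≤ ∫ x, lapIter n (i + 1) w x ^ 2 := integral_nonneg fun x => sq_nonneg _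
    have hE' : (1 + δ) * ∫ x, lapIter n (i + 1) w x ^ 2 ≤ D := by
      refine (mul_le_mul_of_nonneg_left hE (by positivity : 0 ≤ 1 + δ)).trans (le_of_eq ?_)
      rw [hD, hA, hB, hA0]
      ring
    rw [mul_pow] at haS
    calc (1 + 2 ^ 2 * a⁻¹ ^ 2 * S) * (D⁻¹ * ∫ x, lapIter n (i + 1) w x ^ 2)
        ≤ (1 + δ) * (D⁻¹ * ∫ x, lapIter n (i + 1) w x ^ 2) := by gcongr
      _ = D⁻¹ * ((1 + δ) * ∫ x, lapIter n (i + 1) w x ^ 2) := by ring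
      _ ≤ D⁻¹ * D := by gcongr
      _ = 1 := inv_mul_cancel₀ hD0.ne'
  · have hfin := sing_lower hnpos husm.continuous hucs (T := q * L) hα0.le hβ0 hβ hb0 (by positivity) ?_
    · refine lt_of_lt_of_le ?_ hfin
      refine lt_of_lt_of_le hL4 ?_
      have e1 : b ^ (β - n) = a ^ (β - n) * Real.exp ((β - n) * L) := by
        rw [hb, Real.mul_rpow ha.le (Real.exp_pos _).le, ← Real.exp_mul, mul_comm L]
      have e2 : Real.exp (q * L) * Real.exp ((β - n) * L) = Real.exp (δ * L) := by
        rw [← Real.exp_add, hq]; congr 1; ring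
      have e3 : Real.exp ((β - n) * L) ≤ 1 := by
        apply Real.exp_le_one_iff.2
        exact mul_nonpos_of_nonpos_of_nonneg (by linarith) hL0.le
      have e4 : δ * L + 1 ≤ Real.exp (δ * L) := Real.add_one_le_exp _
      have e5 : δ * L ≤ (Real.exp (q * L) - 1) * Real.exp ((β - n) * L) := by
        rw [sub_mul, e2]; linarith
      have e6 := mul_le_mul_of_nonneg_left e5 (show 0 ≤ a ^ (β - n) * V by positivity)
      rw [e1]
      linarith
    · intro x hx
      have hw := hlow x hx
      rw [mul_pow, hsq, ← mul_assoc, mul_comm α, mul_assoc, inv_mul_eq_div, le_div_iff₀ hD0, hD]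
      have hw2 : (L - 2 * M0) ^ 2 ≤ w x ^ 2 := by
        have : 0 ≤ L - 2 * M0 := by linarith
        gcongr
      have hw3 := mul_le_mul_of_nonneg_left hw2 hα0.le
      have hw4 := mul_le_mul_of_nonneg_right hL3 hL0.le
      have hw5 := mul_nonneg hα0.le (sq_nonneg M0)
      clear hE hδα hgap hα1 hα
      linarith
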